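/- For every integer d ≥ 1 and every real x ≥ 0, m(x) = 1 − (Γ((1+d)/2) π x / (Γ(3/2) Γ((2+d)/2))) · Σ_{n=0}^∞ [ (1/2)_n / ((3/2)_n (1+d/2)_n) ] · (−π²x²)^n / n!, where (q)_n = q(q+1)⋯(q+n−1) is the Pochhammer symbol. -/

import Mathlib

open MeasureTheory Real Filter Finset

/-- Bessel function of the first kind of order `α`, via the Poisson integral representation. -/
noncomputable def besselJ (α : ℝ) (t : ℝ) : ℝ :=
  ((t / 2) ^ α / (Real.sqrt π * Real.Gamma (α + 1 / 2))) *
    ∫ θ in (0:ℝ)..π, Real.cos (t * Real.cos θ) * Real.sin θ ^ (2 * α)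

/-- The multiplier `m`, defined by an improper integral (as a limit of interval integrals). -/
noncomputable def mfun (d : ℕ) (x : ℝ) : ℝ :=
  (2 ^ ((d : ℝ) / 2) * Real.Gamma (((d : ℝ) + 1) / 2) / Real.sqrt π) *
    limUnder Filter.atTop
      (fun R : ℝ => ∫ r in (2 * π * x)..R, r ^ (-(d : ℝ) / 2) * besselJ ((d : ℝ) / 2) r)

/-- The Pochhammer symbol `(q)_n = q (q+1) ⋯ (q+n−1)`. -/
noncomputable def poch (q : ℝ) (n : ℕ) : ℝ := ∏ i ∈ Finset.range n, (q + i)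

lemma integral_sin_mul_exp_neg_mul (R t : ℝ) :
    ∫ x in (0:ℝ)..R, sin x * exp (-x * t) =
      (1 + t ^ 2)⁻¹ - exp (-R * t) * (t * sin R + cos R) / (1 + t ^ 2) := by
  have ht : 1 + t ^ 2 ≠ 0 := by positivity
  have h : ∀ x ∈ Set.uIcc 0 R, HasDerivAt
      (fun x ↦ -(exp (-x * t) * (t * sin x + cos x) / (1 + t ^ 2))) (sin x * exp (-x * t)) x := by
    intro x _
    have h1 : HasDerivAt (fun x : ℝ ↦ exp (-x * t)) (exp (-x * t) * (-1 * t)) x :=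
      ((hasDerivAt_id x).neg.mul_const t).exp
    have h2 : HasDerivAt (fun x : ℝ ↦ t * sin x + cos x) (t * cos x + -sin x) x :=
      ((hasDerivAt_sin x).const_mul t).add (hasDerivAt_cos x)
    convert! ((h1.mul h2).div_const (1 + t ^ 2)).neg using 1
    field_simp
    ring
  rw [intervalIntegral.integral_eq_sub_of_hasDerivAt h
    (Continuous.intervalIntegrable (by fun_prop) _ _)]
  simp
  ring

lemma integral_exp_neg_mul_Ioi_zero {x : ℝ} (hx : 0 < x) :
    ∫ t in Set.Ioi (0:ℝ), exp (-x * t) = x⁻¹ := by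
  rw [integral_exp_mul_Ioi (by linarith)]
  simp

lemma integrable_sin_mul_exp_neg_mul {R : ℝ} (hR : 0 < R) :
    Integrable (Function.uncurry fun x t : ℝ ↦ sin x * exp (-x * t))
      ((volume.restrict (Set.uIoc 0 R)).prod (volume.restrict (Set.Ioi 0))) := by
  rw [Set.uIoc_of_le hR.le, integrable_prod_iff (by
    apply Continuous.aestronglyMeasurable
    unfold Function.uncurry
    fun_prop)]
  constructor
  · filter_upwards [ae_restrict_mem measurableSet_Ioc] with x hx
    exact (integrableOn_exp_mul_Ioi (neg_neg_iff_pos.2 hx.1) 0).const_mul (sin x)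
  · have h : ∀ x ∈ Set.Ioc 0 R, ‖sinc x‖ = ∫ t in Set.Ioi (0:ℝ), ‖sin x * exp (-x * t)‖ := by
      intro x hx
      simp_rw [norm_mul, norm_of_nonneg (exp_pos _).le]
      rw [integral_const_mul, integral_exp_neg_mul_Ioi_zero hx.1, sinc_of_ne_zero hx.1.ne',
        norm_div, norm_of_nonneg hx.1.le, div_eq_mul_inv]
    exact IntegrableOn.congr_fun (continuous_sinc.norm.integrableOn_Ioc) h measurableSet_Ioc

lemma abs_integral_sinc_sub_le {R : ℝ} (hR : 0 < R) :
    |(∫ x in (0:ℝ)..R, sinc x) - π / 2| ≤ 2 / R := by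
  have h1 : ∫ x in (0:ℝ)..R, sinc x =
      ∫ x in (0:ℝ)..R, ∫ t in Set.Ioi (0:ℝ), sin x * exp (-x * t) := by
    rw [intervalIntegral.integral_of_le hR.le, intervalIntegral.integral_of_le hR.le]
    refine setIntegral_congr_fun measurableSet_Ioc fun x hx ↦ ?_
    rw [integral_const_mul, integral_exp_neg_mul_Ioi_zero hx.1, sinc_of_ne_zero hx.1.ne',
      div_eq_mul_inv]
  have hE : ∀ t ∈ Set.Ioi (0:ℝ),
      ‖exp (-R * t) * (t * sin R + cos R) / (1 + t ^ 2)‖ ≤ 2 * exp (-R * t) := by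
    intro t ht
    have ht : 0 < t := ht
    have h2 : |t * sin R + cos R| ≤ t + 1 := by
      refine (abs_add_le _ _).trans (add_le_add ?_ (abs_cos_le_one R))
      rw [abs_mul, abs_of_pos ht]
      exact mul_le_of_le_one_right ht.le (abs_sin_le_one R)
    rw [norm_div, norm_mul, norm_of_nonneg (exp_pos _).le,
      norm_of_nonneg (by positivity : 0 ≤ 1 + t ^ 2),
      div_le_iff₀ (by positivity), norm_eq_abs]
    have := mul_le_mul_of_nonneg_left h2 (exp_pos (-R * t)).le
    nlinarith [mul_nonneg (exp_pos (-R * t)).le (by nlinarith [sq_nonneg (t - 1), sq_nonneg t] :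
      0 ≤ 2 * (1 + t ^ 2) - (t + 1))]
  have hexp : IntegrableOn (fun t ↦ 2 * exp (-R * t)) (Set.Ioi 0) :=
    (integrableOn_exp_mul_Ioi (by linarith) 0).const_mul 2
  have hEi : IntegrableOn (fun t ↦ exp (-R * t) * (t * sin R + cos R) / (1 + t ^ 2))
      (Set.Ioi 0) := by
    refine Integrable.mono' hexp ?_ ((ae_restrict_iff' measurableSet_Ioi).2 (ae_of_all _ hE))
    refine Continuous.aestronglyMeasurable ?_
    exact Continuous.div (by fun_prop) (by fun_prop) fun t ↦ by positivity
  rw [h1, intervalIntegral_integral_swap (integrable_sin_mul_exp_neg_mul hR)]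
  simp_rw [integral_sin_mul_exp_neg_mul]
  rw [integral_sub integrable_inv_one_add_sq.integrableOn hEi, integral_Ioi_inv_one_add_sq,
    arctan_zero, sub_zero, sub_sub_cancel_left, abs_neg, ← norm_eq_abs]
  refine (norm_integral_le_of_norm_le hexp
    ((ae_restrict_iff' measurableSet_Ioi).2 (ae_of_all _ hE))).trans ?_
  rw [integral_const_mul, integral_exp_neg_mul_Ioi_zero hR, div_eq_mul_inv]

/-- The Dirichlet integral. -/
lemma tendsto_integral_sinc :
    Tendsto (fun R : ℝ ↦ ∫ x in (0:ℝ)..R, sinc x) atTop (nhds (π / 2)) := by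
  rw [tendsto_iff_norm_sub_tendsto_zero]
  refine squeeze_zero' (Eventually.of_forall fun _ ↦ norm_nonneg _) ?_
    (tendsto_const_nhds.div_atTop tendsto_id : Tendsto (fun R : ℝ ↦ 2 / R) atTop (nhds 0))
  filter_upwards [eventually_gt_atTop 0] with R hR using abs_integral_sinc_sub_le hR

lemma mul_sinc (z : ℝ) : z * sinc z = sin z := by
  rcases eq_or_ne z 0 with rfl | hz
  · simp
  · rw [sinc_of_ne_zero hz, mul_div_cancel₀ _ hz]

/-- The integral over `[0, y]` of `r ↦ ∫ θ in 0..π, cos (r * cos θ) * sin θ ^ d`. -/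
noncomputable def sincIntegral (d : ℕ) (y : ℝ) : ℝ :=
  ∫ θ in (0:ℝ)..π, y * sinc (y * cos θ) * sin θ ^ d

lemma intervalIntegrable_sinc_mul (d : ℕ) (y : ℝ) :
    IntervalIntegrable (fun θ ↦ y * sinc (y * cos θ) * sin θ ^ d) volume 0 π := by
  have := continuous_sinc
  exact Continuous.intervalIntegrable (by fun_prop) _ _

lemma integral_cos_mul_const (y c : ℝ) : ∫ r in (0:ℝ)..y, cos (r * c) = y * sinc (y * c) := by
  rcases eq_or_ne c 0 with rfl | hc
  · simp
  · rw [intervalIntegral.integral_comp_mul_right _ hc, zero_mul, integral_cos, sin_zero, sub_zero,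
      smul_eq_mul, ← mul_sinc (y * c)]
    field_simp

lemma integral_integral_cos (d : ℕ) (y : ℝ) :
    ∫ r in (0:ℝ)..y, ∫ θ in (0:ℝ)..π, cos (r * cos θ) * sin θ ^ d = sincIntegral d y := by
  simp_rw [sincIntegral, intervalIntegral.integral_of_le pi_pos.le]
  rw [intervalIntegral_integral_swap]
  · simp_rw [intervalIntegral.integral_mul_const, integral_cos_mul_const]
  · have : IntegrableOn (Function.uncurry fun r θ : ℝ ↦ cos (r * cos θ) * sin θ ^ d)
        (Set.uIcc 0 y ×ˢ Set.Icc 0 π) (volume.prod volume) := by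
      refine ContinuousOn.integrableOn_compact (isCompact_uIcc.prod isCompact_Icc) ?_
      unfold Function.uncurry
      fun_prop
    rw [Measure.prod_restrict]
    exact this.mono_set (Set.prod_mono Set.uIoc_subset_uIcc Set.Ioc_subset_Icc_self)

lemma continuous_integral_cos (d : ℕ) :
    Continuous fun r : ℝ ↦ ∫ θ in (0:ℝ)..π, cos (r * cos θ) * sin θ ^ d := by
  apply intervalIntegral.continuous_parametric_intervalIntegral_of_continuous'
  unfold Function.uncurry
  fun_prop

lemma tendsto_integral_sin_mul_deriv {h h' : ℝ → ℝ}
    (hh : ∀ θ ∈ Set.uIcc 0 π, HasDerivAt h (h' θ) θ) (hh' : ContinuousOn h' (Set.uIcc 0 π)) :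
    Tendsto (fun R ↦ ∫ θ in (0:ℝ)..π, sin (R * cos θ) * sin θ * h θ) atTop (nhds 0) := by
  obtain ⟨C, hC⟩ := isCompact_uIcc.exists_bound_of_continuousOn hh'
  have hcont : ContinuousOn h (Set.uIcc 0 π) := fun θ hθ ↦ (hh θ hθ).continuousAt.continuousWithinAt
  have key : ∀ R : ℝ, 0 < R → ‖∫ θ in (0:ℝ)..π, sin (R * cos θ) * sin θ * h θ‖ ≤
      (|h π| + |h 0| + C * π) / R := by
    intro R hR
    have hv : ∀ θ ∈ Set.uIcc 0 π, HasDerivAt (fun θ ↦ cos (R * cos θ) / R)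
        (sin (R * cos θ) * sin θ) θ := by
      intro θ _
      convert! (((hasDerivAt_cos θ).const_mul R).cos.div_const R) using 1
      field_simp
    have e := intervalIntegral.integral_mul_deriv_eq_deriv_mul hh hv hh'.intervalIntegrable
      (Continuous.intervalIntegrable (by fun_prop) _ _)
    have e2 : ∫ θ in (0:ℝ)..π, sin (R * cos θ) * sin θ * h θ =
        ∫ θ in (0:ℝ)..π, h θ * (sin (R * cos θ) * sin θ) := by
      congr 1; ext θ; ring
    have hc : ∀ z, |cos z / R| ≤ 1 / R := fun z ↦ by
      rw [abs_div, abs_of_pos hR]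
      exact div_le_div_of_nonneg_right (abs_cos_le_one z) hR.le
    have hI : ‖∫ θ in (0:ℝ)..π, h' θ * (cos (R * cos θ) / R)‖ ≤ (C * (1 / R)) * |π - 0| := by
      refine intervalIntegral.norm_integral_le_of_norm_le_const fun θ hθ ↦ ?_
      rw [norm_mul]
      have h1 := hC θ (Set.uIoc_subset_uIcc hθ)
      exact mul_le_mul h1 (hc _) (norm_nonneg _) ((norm_nonneg _).trans h1)
    rw [e2, e]
    have hb : ∀ a z, ‖h a * (cos z / R)‖ ≤ |h a| * (1 / R) := fun a z ↦ by
      rw [norm_mul]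
      exact mul_le_mul_of_nonneg_left (hc _) (abs_nonneg _)
    refine (norm_sub_le_of_le (norm_sub_le_of_le (hb _ _) (hb _ _)) hI).trans (le_of_eq ?_)
    rw [sub_zero, abs_of_pos pi_pos]
    ring
  refine squeeze_zero_norm' ?_ (tendsto_const_nhds.div_atTop tendsto_id :
    Tendsto (fun R : ℝ ↦ (|h π| + |h 0| + C * π) / R) atTop (nhds 0))
  filter_upwards [eventually_gt_atTop 0] with R hR using key R hR

lemma tendsto_sincIntegral_of_sub {a b : ℕ} {L : ℝ} {h h' : ℝ → ℝ}
    (hb : Tendsto (sincIntegral b) atTop (nhds L))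
    (hab : ∀ θ ∈ Set.uIcc 0 π, sin θ ^ b - sin θ ^ a = cos θ * (sin θ * h θ))
    (hh : ∀ θ ∈ Set.uIcc 0 π, HasDerivAt h (h' θ) θ) (hh' : ContinuousOn h' (Set.uIcc 0 π)) :
    Tendsto (sincIntegral a) atTop (nhds L) := by
  have := hb.sub (tendsto_integral_sin_mul_deriv hh hh')
  rw [sub_zero] at this
  refine this.congr fun R ↦ ?_
  rw [sub_eq_iff_eq_add, ← sub_eq_iff_eq_add', sincIntegral, sincIntegral,
    ← intervalIntegral.integral_sub (intervalIntegrable_sinc_mul b R)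
      (intervalIntegrable_sinc_mul a R)]
  refine intervalIntegral.integral_congr fun θ hθ ↦ ?_
  rw [← mul_sub, hab θ hθ]
  linear_combination sin θ * h θ * mul_sinc (R * cos θ)

lemma sincIntegral_one (R : ℝ) : sincIntegral 1 R = 2 * ∫ x in (0:ℝ)..R, sinc x := by
  have e := intervalIntegral.integral_comp_mul_deriv (a := 0) (b := π)
    (f := fun θ ↦ R * cos θ) (f' := fun θ ↦ R * (-sin θ))
    (fun θ _ ↦ (hasDerivAt_cos θ).const_mul R) (by fun_prop) continuous_sinc
  have hi : ∀ a b, IntervalIntegrable sinc volume a b := fun a b ↦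
    continuous_sinc.intervalIntegrable a b
  have e2 : sincIntegral 1 R =
      -∫ θ in (0:ℝ)..π, (sinc ∘ fun θ ↦ R * cos θ) θ * (R * (-sin θ)) := by
    rw [sincIntegral, ← intervalIntegral.integral_neg]
    congr 1; ext θ; simp only [Function.comp]; ring
  have e3 : ∫ x in (-R)..0, sinc x = ∫ x in (0:ℝ)..R, sinc x := by
    have := intervalIntegral.integral_comp_neg (a := 0) (b := R) sinc
    simpa using this.symm
  rw [e2, e, cos_pi, cos_zero, ← intervalIntegral.integral_symm, mul_one, mul_neg_one,
    ← intervalIntegral.integral_add_adjacent_intervals (hi (-R) 0) (hi 0 R), e3, two_mul]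

lemma tendsto_sincIntegral_one : Tendsto (sincIntegral 1) atTop (nhds π) := by
  have := tendsto_integral_sinc.const_mul 2
  rw [mul_div_cancel₀ _ two_ne_zero] at this
  exact this.congr fun R ↦ (sincIntegral_one R).symm

lemma tendsto_sincIntegral (n : ℕ) : Tendsto (sincIntegral (n + 1)) atTop (nhds π) := by
  induction n using Nat.twoStepInduction with
  | zero => exact tendsto_sincIntegral_one
  | one =>
    have hs : ∀ θ ∈ Set.uIcc 0 π, 1 + sin θ ≠ 0 := fun θ hθ ↦ by
      rw [Set.uIcc_of_le pi_pos.le] at hθ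
      linarith [sin_nonneg_of_mem_Icc hθ]
    refine tendsto_sincIntegral_of_sub (h := fun θ ↦ cos θ / (1 + sin θ))
      (h' := fun θ ↦ (-sin θ * (1 + sin θ) - cos θ * cos θ) / (1 + sin θ) ^ 2)
      tendsto_sincIntegral_one ?_ ?_ ?_
    · intro θ hθ
      have := hs θ hθ
      field_simp
      rw [cos_sq']
      ring
    · intro θ hθ
      exact (hasDerivAt_cos θ).div ((hasDerivAt_sin θ).const_add 1) (hs θ hθ)
    · exact ContinuousOn.div (by fun_prop) (by fun_prop) fun θ hθ ↦ pow_ne_zero 2 (hs θ hθ)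
  | more n ih _ =>
    refine tendsto_sincIntegral_of_sub (h := fun θ ↦ cos θ * sin θ ^ n)
      (h' := fun θ ↦ -sin θ * sin θ ^ n + cos θ * (n * sin θ ^ (n - 1) * cos θ)) ih ?_ ?_ ?_
    · intro θ _
      have := cos_sq' θ
      linear_combination (-sin θ ^ (n + 1)) * this
    · intro θ _
      exact (hasDerivAt_cos θ).mul ((hasDerivAt_sin θ).pow n)
    · fun_prop

lemma poch_succ (q : ℝ) (n : ℕ) : poch q (n + 1) = poch q n * (q + n) :=
  prod_range_succ _ _

lemma poch_pos {q : ℝ} (hq : 0 < q) (n : ℕ) : 0 < poch q n :=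
  prod_pos fun i _ ↦ by positivity

lemma factorial_two_mul_add_one (k : ℕ) :
    ((2 * k + 1).factorial : ℝ) = 4 ^ k * k.factorial * poch (3 / 2) k := by
  induction k with
  | zero => simp [poch]
  | succ k ih =>
    rw [poch_succ, show 2 * (k + 1) + 1 = (2 * k + 1) + 1 + 1 by ring, Nat.factorial_succ,
      Nat.factorial_succ, Nat.factorial_succ k, pow_succ]
    push_cast
    rw [ih]
    ring

lemma integral_sin_pow_eq_Gamma (d : ℕ) :
    ∫ θ in (0:ℝ)..π, sin θ ^ d = √π * Gamma ((d + 1) / 2) / Gamma (d / 2 + 1) := by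
  induction d using Nat.twoStepInduction with
  | zero => simp [-one_div, Gamma_one_half_eq, mul_self_sqrt pi_pos.le]
  | one =>
    have h1 : Gamma ((1:ℝ) / 2 + 1) = 1 / 2 * √π := by
      rw [Gamma_add_one (by norm_num), Gamma_one_half_eq]
    have : √π ≠ 0 := by positivity
    simp only [pow_one, integral_sin, cos_zero, cos_pi, Nat.cast_one, h1]
    norm_num
    field_simp
  | more n ih _ =>
    have hG : Gamma ((n:ℝ) / 2 + 1) ≠ 0 := (Gamma_pos_of_pos (by positivity)).ne'
    rw [integral_sin_pow, ih]
    push_cast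
    rw [show ((n:ℝ) + 2 + 1) / 2 = (n + 1) / 2 + 1 by ring,
      show ((n:ℝ) + 2) / 2 + 1 = (n / 2 + 1) + 1 by ring,
      Gamma_add_one (by positivity : ((n:ℝ) + 1) / 2 ≠ 0),
      Gamma_add_one (by positivity : (n:ℝ) / 2 + 1 ≠ 0)]
    simp only [sin_zero, sin_pi]
    field_simp
    ring

lemma integral_cos_pow_mul_sin_pow_succ (d k : ℕ) :
    (2 * k + 2 + d) * ∫ θ in (0:ℝ)..π, cos θ ^ (2 * (k + 1)) * sin θ ^ d =
      (2 * k + 1) * ∫ θ in (0:ℝ)..π, cos θ ^ (2 * k) * sin θ ^ d := by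
  have h : ∀ θ ∈ Set.uIcc 0 π, HasDerivAt (fun θ ↦ cos θ ^ (2 * k + 1) * sin θ ^ (d + 1))
      ((2 * k + 2 + d) * (cos θ ^ (2 * (k + 1)) * sin θ ^ d) -
        (2 * k + 1) * (cos θ ^ (2 * k) * sin θ ^ d)) θ := by
    intro θ _
    convert! ((hasDerivAt_cos θ).pow (2 * k + 1)).mul ((hasDerivAt_sin θ).pow (d + 1)) using 1
    have h1 := cos_sq' θ
    simp only [add_tsub_cancel_right, Pi.pow_apply]
    push_cast
    linear_combination (-(2 * k + 1) * cos θ ^ (2 * k) * sin θ ^ d) * -h1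
  have := intervalIntegral.integral_eq_sub_of_hasDerivAt h
    (Continuous.intervalIntegrable (by fun_prop) _ _)
  rw [intervalIntegral.integral_sub (Continuous.intervalIntegrable (by fun_prop) _ _)
    (Continuous.intervalIntegrable (by fun_prop) _ _), intervalIntegral.integral_const_mul,
    intervalIntegral.integral_const_mul] at this
  simpa [sub_eq_zero] using this

lemma integral_cos_pow_mul_sin_pow (d k : ℕ) :
    ∫ θ in (0:ℝ)..π, cos θ ^ (2 * k) * sin θ ^ d =
      √π * Gamma ((d + 1) / 2) / Gamma (d / 2 + 1) *
        (poch (1 / 2) k / poch (1 + d / 2) k) := by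
  induction k with
  | zero => simp [poch, integral_sin_pow_eq_Gamma]
  | succ k ih =>
    have h := integral_cos_pow_mul_sin_pow_succ d k
    rw [ih] at h
    have hp : poch (1 + d / 2) k ≠ 0 := (poch_pos (by positivity) k).ne'
    have hG : Gamma ((d:ℝ) / 2 + 1) ≠ 0 := (Gamma_pos_of_pos (by positivity)).ne'
    have h0 : (2 * k + 2 + d : ℝ) ≠ 0 := by positivity
    have h2 : (1 + d / 2 + k : ℝ) ≠ 0 := by positivity
    apply mul_left_cancel₀ h0
    rw [h, poch_succ, poch_succ]
    field_simp
    ring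

lemma hasSum_mul_sinc (y c : ℝ) :
    HasSum (fun k : ℕ ↦ (-1) ^ k * y ^ (2 * k + 1) / (2 * k + 1).factorial * c ^ (2 * k))
      (y * sinc (y * c)) := by
  rcases eq_or_ne c 0 with rfl | hc
  · convert! hasSum_ite_eq 0 y using 1
    · ext k
      rcases k with _ | k <;> simp
    · simp
  · have h := (hasSum_sin (y * c)).div_const c
    rw [← mul_sinc, mul_right_comm, mul_div_cancel_right₀ _ hc] at h
    convert! h using 1
    ext k
    rw [mul_pow, pow_succ c]
    field_simp

lemma hasSum_sincIntegral (d : ℕ) (y : ℝ) :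
    HasSum (fun k : ℕ ↦ (-1) ^ k * y ^ (2 * k + 1) / (2 * k + 1).factorial *
      ∫ θ in (0:ℝ)..π, cos θ ^ (2 * k) * sin θ ^ d) (sincIntegral d y) := by
  simp_rw [← intervalIntegral.integral_const_mul]
  refine intervalIntegral.hasSum_integral_of_dominated_convergence
    (fun k _ ↦ |y| ^ (2 * k + 1) / (2 * k + 1).factorial) (fun k ↦ ?_) (fun k ↦ ?_)
    (ae_of_all _ fun _ _ ↦ (hasSum_sinh |y|).summable) intervalIntegrable_const
    (ae_of_all _ fun θ _ ↦ ?_)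
  · exact Continuous.aestronglyMeasurable (by fun_prop)
  · refine ae_of_all _ fun θ _ ↦ ?_
    have h1 : |cos θ| ^ (2 * k) * |sin θ| ^ d ≤ 1 :=
      mul_le_one₀ (pow_le_one₀ (abs_nonneg _) (abs_cos_le_one θ)) (by positivity)
        (pow_le_one₀ (abs_nonneg _) (abs_sin_le_one θ))
    simp only [norm_mul, norm_div, norm_pow, norm_neg, norm_one, one_pow, one_mul, norm_eq_abs,
      Nat.abs_cast]
    exact mul_le_of_le_one_right (by positivity) h1
  · simpa only [mul_assoc] using (hasSum_mul_sinc y (cos θ)).mul_right (sin θ ^ d)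

lemma rpow_mul_besselJ (d : ℕ) {r : ℝ} (hr : 0 < r) :
    r ^ (-(d : ℝ) / 2) * besselJ ((d : ℝ) / 2) r =
      (2 ^ ((d : ℝ) / 2) * √π * Gamma ((d + 1) / 2))⁻¹ *
        ∫ θ in (0:ℝ)..π, cos (r * cos θ) * sin θ ^ d := by
  have h1 : r ^ ((d : ℝ) / 2) ≠ 0 := (rpow_pos_of_pos hr _).ne'
  have h2 : (2:ℝ) ^ ((d : ℝ) / 2) ≠ 0 := (rpow_pos_of_pos two_pos _).ne'
  have h3 : Gamma (((d : ℝ) + 1) / 2) ≠ 0 := (Gamma_pos_of_pos (by positivity)).ne'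
  rw [besselJ, mul_div_cancel₀ _ two_ne_zero, div_rpow hr.le two_pos.le, neg_div, rpow_neg hr.le,
    ← add_div]
  simp_rw [rpow_natCast]
  field_simp

lemma tendsto_integral_rpow_mul_besselJ (n : ℕ) {y : ℝ} (hy : 0 ≤ y) :
    Tendsto (fun R : ℝ ↦ ∫ r in y..R,
        r ^ (-((n + 1 : ℕ) : ℝ) / 2) * besselJ (((n + 1 : ℕ) : ℝ) / 2) r) atTop
      (nhds ((2 ^ (((n + 1 : ℕ) : ℝ) / 2) * √π * Gamma (((n + 1 : ℕ) + 1) / 2))⁻¹ *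
        (π - sincIntegral (n + 1) y))) := by
  refine (((tendsto_sincIntegral n).sub_const _).const_mul _).congr' ?_
  filter_upwards [eventually_ge_atTop y] with R hR
  have hc := continuous_integral_cos (n + 1)
  rw [← integral_integral_cos, ← integral_integral_cos,
    intervalIntegral.integral_interval_sub_left (hc.intervalIntegrable _ _)
      (hc.intervalIntegrable _ _), ← intervalIntegral.integral_const_mul,
    intervalIntegral.integral_of_le hR, intervalIntegral.integral_of_le hR]
  exact setIntegral_congr_fun measurableSet_Ioc fun r hr ↦
    (rpow_mul_besselJ (n + 1) (hy.trans_lt hr.1)).symm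

lemma mfun_eq_one_sub (d : ℕ) (hd : 1 ≤ d) (x : ℝ) (hx : 0 ≤ x) :
    mfun d x = 1 - sincIntegral d (2 * π * x) / π := by
  obtain ⟨n, rfl⟩ := Nat.exists_eq_add_of_le' hd
  rw [mfun, (tendsto_integral_rpow_mul_besselJ n (by positivity)).limUnder_eq]
  have h2 : (2:ℝ) ^ (((n + 1 : ℕ) : ℝ) / 2) ≠ 0 := (rpow_pos_of_pos two_pos _).ne'
  have h3 : Gamma ((((n + 1 : ℕ) : ℝ) + 1) / 2) ≠ 0 := (Gamma_pos_of_pos (by positivity)).ne'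
  field_simp
  rw [sq_sqrt pi_pos.le]

/-- For every integer `d ≥ 1` and every real `x ≥ 0`,
`m(x) = 1 − (Γ((1+d)/2) π x / (Γ(3/2) Γ((2+d)/2))) · ₁F₂[1/2; 3/2, 1+d/2; −π²x²]`. -/
theorem statement18 (d : ℕ) (hd : 1 ≤ d) (x : ℝ) (hx : 0 ≤ x) :
    mfun d x = 1 -
      (Real.Gamma ((1 + (d : ℝ)) / 2) * π * x /
          (Real.Gamma (3 / 2) * Real.Gamma ((2 + (d : ℝ)) / 2))) *
        ∑' n : ℕ, (poch (1 / 2) n / (poch (3 / 2) n * poch (1 + (d : ℝ) / 2) n)) *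
          (-(π ^ 2) * x ^ 2) ^ n / n.factorial := by
  rw [mfun_eq_one_sub d hd x hx, ← (hasSum_sincIntegral d _).tsum_eq, ← tsum_div_const,
    ← tsum_mul_left]
  congr 2
  ext k
  have h32 : Gamma (3 / 2) = 1 / 2 * √π := by
    rw [show (3:ℝ) / 2 = 1 / 2 + 1 by norm_num, Gamma_add_one (by norm_num), Gamma_one_half_eq]
  have hG : Gamma ((d:ℝ) / 2 + 1) ≠ 0 := (Gamma_pos_of_pos (by positivity)).ne'
  have hp : poch (1 + d / 2) k ≠ 0 := (poch_pos (by positivity) k).ne'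
  have hp' : poch (3 / 2) k ≠ 0 := (poch_pos (by positivity) k).ne'
  have hpow : (-1) ^ k * (2 * π * x) ^ (2 * k + 1) =
      2 * π * x * 4 ^ k * (-(π ^ 2) * x ^ 2) ^ k := by
    rw [pow_succ, pow_mul, mul_comm _ (2 * π * x), mul_left_comm, mul_assoc _ (4 ^ k), ← mul_pow,
      ← mul_pow]
    congr 2
    ring
  rw [integral_cos_pow_mul_sin_pow, factorial_two_mul_add_one, hpow, h32,
    show (2 + (d:ℝ)) / 2 = d / 2 + 1 by ring, add_comm 1 (d:ℝ)]
  have hs : √π ^ 2 = π := sq_sqrt pi_pos.le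
  field_simp
  rw [hs]
  ring
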